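/- arXiv:2012.10919 — 4 statements merged into one kernel-verified Lean document; each statement's English description precedes it below -/
import Mathlib

section
/- With the ring-gadget construction below, the distance function d_Y : Y × Y → ℝ is a metric on Y (it is non-negative, symmetric, vanishes exactly on the diagonal, and satisfies the triangle inequality). -/
/-- Circular distance between the `j`-th and `j'`-th of `m` points spaced regularly
on a circle of perimeter 1: `(1/m) · min(j'−j, m+j−j')` for `j ≤ j'`. -/
noncomputable def ringDist (m : ℕ) (j j' : Fin m) : ℝ :=
  ((min (max j.val j'.val - min j.val j'.val)
        (m - (max j.val j'.val - min j.val j'.val)) : ℕ) : ℝ) / (m : ℝ)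

/-- The distance on `Y = R_1 ∪ … ∪ R_k`, where `R_i = {p_{i1},…,p_{im}}` and the
point `p_{ij}` (with `1 ≤ i ≤ k`, `1 ≤ j ≤ m`) is encoded as
`(⟨i-1⟩, ⟨j-1⟩) : Fin k × Fin m`.  Within a ring the distance is the circular
distance `ringDist`; for `i ≠ i'`, `d_Y(p_{ij}, p_{i'j'}) = 2^{max(i,i')}` if
`(v_j, v_{j'}) ∈ E` and `2^{max(i,i')} − 1/m` otherwise (note
`max(i,i') = max(i-1,i'-1) + 1` in the 0-indexed encoding). -/
noncomputable def dY (m k : ℕ) (G : SimpleGraph (Fin m)) [DecidableRel G.Adj]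
    (p q : Fin k × Fin m) : ℝ :=
  if p.1 = q.1 then ringDist m p.2 q.2
  else if G.Adj p.2 q.2 then (2 : ℝ) ^ (max p.1.val q.1.val + 1)
  else (2 : ℝ) ^ (max p.1.val q.1.val + 1) - 1 / (m : ℝ)

/-- The distance on the pattern `X = {x_1,…,x_k}` (point `x_i` encoded as
`⟨i-1⟩ : Fin k`): `d_X(x_i, x_{i'}) = 2^{max(i,i')} · ρ` for `i ≠ i'`. -/
noncomputable def dX (k : ℕ) (ρ : ℝ) (i i' : Fin k) : ℝ :=
  if i = i' then 0 else (2 : ℝ) ^ (max i.val i'.val + 1) * ρ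

/-- `σ` is a `ρ`-matching from `(A, dA)` to `(B, dB)`:
`(1/ρ)·dA(a,a') ≤ dB(σ a, σ a') ≤ ρ·dA(a,a')` for all `a, a'`. -/
def IsRhoMatching {A B : Type*} (dA : A → A → ℝ) (dB : B → B → ℝ)
    (ρ : ℝ) (σ : A → B) : Prop :=
  ∀ a a', (1 / ρ) * dA a a' ≤ dB (σ a) (σ a') ∧ dB (σ a) (σ a') ≤ ρ * dA a a'

/-- The ring distance is nonnegative. -/
lemma ringDist_nonneg (m : ℕ) (a b : Fin m) : 0 ≤ ringDist m a b := by
  unfold ringDist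
  positivity

lemma ringDist_comm (m : ℕ) (a b : Fin m) : ringDist m a b = ringDist m b a := by
  unfold ringDist
  rw [max_comm, min_comm a.val]

lemma ringDist_self (m : ℕ) (a : Fin m) : ringDist m a a = 0 := by
  simp [ringDist]

/-- Distinct points of a ring are at distance at least one step. -/
lemma one_div_le_ringDist (m : ℕ) {a b : Fin m} (h : a ≠ b) :
    1 / (m : ℝ) ≤ ringDist m a b := by
  unfold ringDist
  have ha := a.isLt
  have hb := b.isLt
  have hab : a.val ≠ b.val := fun e => h (Fin.ext e)
  gcongr
  rw [Nat.one_le_cast]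
  omega

lemma ringDist_le_one (m : ℕ) (a b : Fin m) : ringDist m a b ≤ 1 := by
  unfold ringDist
  apply div_le_one_of_le₀ _ (Nat.cast_nonneg m)
  rw [Nat.cast_le]
  omega

lemma ringDist_triangle (m : ℕ) (a b c : Fin m) :
    ringDist m a c ≤ ringDist m a b + ringDist m b c := by
  unfold ringDist
  rw [← add_div]
  have ha := a.isLt
  have hb := b.isLt
  have hc := c.isLt
  gcongr
  rw [← Nat.cast_add, Nat.cast_le]
  omega

lemma ringDist_eq_zero_iff (m : ℕ) {a b : Fin m} : ringDist m a b = 0 ↔ a = b := by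
  refine ⟨fun h => ?_, fun h => h ▸ ringDist_self m a⟩
  by_contra hne
  have hm : (0 : ℝ) < m := by exact_mod_cast a.pos
  have := one_div_le_ringDist m hne
  have : 0 < 1 / (m : ℝ) := by positivity
  linarith

lemma dY_of_eq (m k : ℕ) (G : SimpleGraph (Fin m)) [DecidableRel G.Adj]
    {p q : Fin k × Fin m} (h : p.1 = q.1) : dY m k G p q = ringDist m p.2 q.2 :=
  if_pos h

lemma dY_comm (m k : ℕ) (G : SimpleGraph (Fin m)) [DecidableRel G.Adj]
    (p q : Fin k × Fin m) : dY m k G p q = dY m k G q p := by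
  unfold dY
  simp only [eq_comm (a := p.1), G.adj_comm p.2, ringDist_comm m p.2, max_comm p.1.val]

lemma dY_le_of_ne (m k : ℕ) (G : SimpleGraph (Fin m)) [DecidableRel G.Adj]
    {p q : Fin k × Fin m} (h : p.1 ≠ q.1) :
    dY m k G p q ≤ 2 ^ (max p.1.val q.1.val + 1) := by
  have : 0 ≤ 1 / (m : ℝ) := by positivity
  rw [dY, if_neg h]
  split_ifs <;> linarith

lemma le_dY_of_ne (m k : ℕ) (G : SimpleGraph (Fin m)) [DecidableRel G.Adj]
    {p q : Fin k × Fin m} (h : p.1 ≠ q.1) :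
    2 ^ (max p.1.val q.1.val + 1) - 1 / (m : ℝ) ≤ dY m k G p q := by
  have : 0 ≤ 1 / (m : ℝ) := by positivity
  rw [dY, if_neg h]
  split_ifs <;> linarith

/-- Points in different rings are at distance at least three. -/
lemma three_le_dY_of_ne (m k : ℕ) (G : SimpleGraph (Fin m)) [DecidableRel G.Adj]
    {p q : Fin k × Fin m} (h : p.1 ≠ q.1) : 3 ≤ dY m k G p q := by
  have hne : p.1.val ≠ q.1.val := fun e => h (Fin.ext e)
  have hpow : (2 : ℝ) ^ 2 ≤ 2 ^ (max p.1.val q.1.val + 1) :=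
    pow_le_pow_right₀ one_le_two (by omega)
  have hm : 1 / (m : ℝ) ≤ 1 := by simpa using Nat.cast_inv_le_one m
  linarith [le_dY_of_ne m k G h]

lemma dY_nonneg (m k : ℕ) (G : SimpleGraph (Fin m)) [DecidableRel G.Adj]
    (p q : Fin k × Fin m) : 0 ≤ dY m k G p q := by
  by_cases h : p.1 = q.1
  · exact dY_of_eq m k G h ▸ ringDist_nonneg m p.2 q.2
  · linarith [three_le_dY_of_ne m k G h]

lemma dY_eq_zero_iff (m k : ℕ) (G : SimpleGraph (Fin m)) [DecidableRel G.Adj]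
    {p q : Fin k × Fin m} : dY m k G p q = 0 ↔ p = q := by
  rw [Prod.ext_iff]
  by_cases h : p.1 = q.1
  · rw [dY_of_eq m k G h, ringDist_eq_zero_iff]
    simp [h]
  · have := three_le_dY_of_ne m k G h
    simp only [h, false_and, iff_false]
    linarith

/-- The triangle inequality when the first two points share a ring that does not contain the
third. -/
lemma dY_triangle_of_eq_of_ne (m k : ℕ) (G : SimpleGraph (Fin m)) [DecidableRel G.Adj]
    {p q s : Fin k × Fin m} (hpq : p.1 = q.1) (hqs : q.1 ≠ s.1) :
    dY m k G p s ≤ dY m k G p q + dY m k G q s := by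
  by_cases h : p.2 = q.2
  · rw [Prod.ext hpq h]
    linarith [dY_nonneg m k G q q]
  · have hps : p.1 ≠ s.1 := hpq ▸ hqs
    have h₁ := dY_le_of_ne m k G hps
    have h₂ := le_dY_of_ne m k G hqs
    have h₃ := one_div_le_ringDist m h
    rw [dY_of_eq m k G hpq]
    rw [hpq] at h₁
    linarith

lemma dY_triangle (m k : ℕ) (G : SimpleGraph (Fin m)) [DecidableRel G.Adj]
    (p q s : Fin k × Fin m) :
    dY m k G p s ≤ dY m k G p q + dY m k G q s := by
  by_cases hpq : p.1 = q.1
  · by_cases hqs : q.1 = s.1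
    · rw [dY_of_eq m k G hpq, dY_of_eq m k G hqs, dY_of_eq m k G (hpq.trans hqs)]
      exact ringDist_triangle m p.2 q.2 s.2
    · exact dY_triangle_of_eq_of_ne m k G hpq hqs
  by_cases hqs : q.1 = s.1
  · rw [dY_comm m k G p s, dY_comm m k G p q, dY_comm m k G q s, add_comm]
    exact dY_triangle_of_eq_of_ne m k G hqs.symm (Ne.symm hpq)
  have hpq₃ := three_le_dY_of_ne m k G hpq
  have hqs₃ := three_le_dY_of_ne m k G hqs
  by_cases hps : p.1 = s.1
  · rw [dY_of_eq m k G hps]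
    linarith [ringDist_le_one m p.2 s.2]
  have hps_le := dY_le_of_ne m k G hps
  have hpq_le := le_dY_of_ne m k G hpq
  have hqs_le := le_dY_of_ne m k G hqs
  have hm : 1 / (m : ℝ) ≤ 1 := by simpa using Nat.cast_inv_le_one m
  rcases le_total s.1.val p.1.val with h | h
  · have : (2 : ℝ) ^ (max p.1.val s.1.val + 1) ≤ 2 ^ (max p.1.val q.1.val + 1) :=
      pow_le_pow_right₀ one_le_two (by omega)
    linarith
  · have : (2 : ℝ) ^ (max p.1.val s.1.val + 1) ≤ 2 ^ (max q.1.val s.1.val + 1) :=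
      pow_le_pow_right₀ one_le_two (by omega)
    linarith

/-- **Lemma (d_Y is a metric).** With the ring-gadget construction (for a simple
graph `G` on `m ≥ 24` vertices and `k ≥ 1` rings), `d_Y` is non-negative,
symmetric, vanishes exactly on the diagonal, and satisfies the triangle
inequality. -/
theorem stmt_3 (m k : ℕ) (hm : 24 ≤ m) (hk : 1 ≤ k)
    (G : SimpleGraph (Fin m)) [DecidableRel G.Adj] :
    (∀ p q : Fin k × Fin m, 0 ≤ dY m k G p q) ∧
    (∀ p q : Fin k × Fin m, dY m k G p q = dY m k G q p) ∧
    (∀ p q : Fin k × Fin m, dY m k G p q = 0 ↔ p = q) ∧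
    (∀ p q s : Fin k × Fin m, dY m k G p s ≤ dY m k G p q + dY m k G q s) := by
  exact ⟨dY_nonneg m k G, dY_comm m k G, fun _ _ => dY_eq_zero_iff m k G, dY_triangle m k G⟩
end

section
/- Let k ≥ 1, ρ ≥ 1, and let X = {x_1,…,x_k} with d_X(x_i,x_i) = 0 and d_X(x_i,x_{i'}) = 2^{max(i,i')}·ρ for i ≠ i'. Then (X,d_X) is a metric space of doubling dimension log₂ 3; that is, d_X is a metric and every closed ball in (X,d_X) is contained in the union of at most 3 closed balls of half its radius. -/
theorem dX_nonneg {k : ℕ} {ρ : ℝ} (hρ : 0 ≤ ρ) (i j : Fin k) : 0 ≤ dX k ρ i j := by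
  unfold dX
  split_ifs <;> positivity

theorem dX_self {k : ℕ} (ρ : ℝ) (i : Fin k) : dX k ρ i i = 0 := by
  simp [dX]

theorem dX_of_ne {k : ℕ} (ρ : ℝ) {i j : Fin k} (h : i ≠ j) :
    dX k ρ i j = (2 : ℝ) ^ (max i.val j.val + 1) * ρ := by
  simp [dX, h]

theorem dX_comm {k : ℕ} (ρ : ℝ) (i j : Fin k) : dX k ρ i j = dX k ρ j i := by
  simp only [dX, eq_comm, max_comm]

theorem dX_eq_zero_iff {k : ℕ} {ρ : ℝ} (hρ : 0 < ρ) (i j : Fin k) :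
    dX k ρ i j = 0 ↔ i = j := by
  simp [dX, hρ.ne']

theorem dX_le {k : ℕ} {ρ : ℝ} (hρ : 0 ≤ ρ) {i j : Fin k} {n : ℕ}
    (hi : i.val ≤ n) (hj : j.val ≤ n) : dX k ρ i j ≤ (2 : ℝ) ^ (n + 1) * ρ := by
  unfold dX
  split_ifs
  · positivity
  · gcongr
    · norm_num
    · exact max_le hi hj

theorem le_dX_left {k : ℕ} {ρ : ℝ} (hρ : 0 ≤ ρ) {i j : Fin k} (h : i ≠ j) :
    (2 : ℝ) ^ (i.val + 1) * ρ ≤ dX k ρ i j := by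
  rw [dX_of_ne ρ h]
  gcongr
  · norm_num
  · exact le_max_left _ _

theorem dX_triangle {k : ℕ} {ρ : ℝ} (hρ : 0 ≤ ρ) (i j l : Fin k) :
    dX k ρ i l ≤ dX k ρ i j + dX k ρ j l := by
  by_cases hij : i = j
  · simp [hij, dX_self]
  by_cases hjl : j = l
  · simp [hjl, dX_self]
  have h₁ := le_dX_left hρ hij
  have h₂ := le_dX_left hρ (Ne.symm hjl)
  rw [dX_comm] at h₂
  have h₃ := dX_nonneg hρ i j
  have h₄ := dX_nonneg hρ j l
  rcases le_total i.val l.val with h | h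
  · linarith [dX_le hρ h le_rfl]
  · linarith [dX_le hρ le_rfl h]

/-- A closed ball is covered by the half-radius balls around its point of largest index and
around the point of index zero. -/
theorem exists_ball_subset_two_half_balls {k : ℕ} (hk : 1 ≤ k) {ρ : ℝ} (hρ : 0 ≤ ρ)
    (i : Fin k) (r : ℝ) : ∃ c₁ c₂ : Fin k,
      {j : Fin k | dX k ρ i j ≤ r} ⊆
        {j | dX k ρ c₁ j ≤ r / 2} ∪ {j | dX k ρ c₂ j ≤ r / 2} := by
  rcases lt_or_ge r 0 with hr | hr
  · exact ⟨i, i, fun j hj => absurd (hj.trans_lt hr) (dX_nonneg hρ i j).not_gt⟩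
  obtain ⟨M, hM, hmax⟩ := Set.exists_max_image {j : Fin k | dX k ρ i j ≤ r} id
    (Set.toFinite _) ⟨i, by simpa [dX_self] using hr⟩
  refine ⟨M, ⟨0, hk⟩, fun j hj => ?_⟩
  rcases (hmax j hj).eq_or_lt with h | h
  · left
    obtain rfl : j = M := h
    simp only [Set.mem_ofPred_eq, dX_self]
    positivity
  · right
    have hlt : j.val < M.val := h
    have hMr : (2 : ℝ) ^ (M.val + 1) * ρ ≤ r := by
      by_cases hiM : M = i
      · subst hiM
        exact (le_dX_left hρ h.ne').trans hj
      · exact ((le_dX_left hρ hiM).trans_eq (dX_comm ρ M i)).trans hM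
    have hpow : (2 : ℝ) ^ (j.val + 1) * ρ ≤ 2 ^ M.val * ρ := by
      gcongr
      · norm_num
      · exact hlt
    have hle : dX k ρ ⟨0, hk⟩ j ≤ (2 : ℝ) ^ (j.val + 1) * ρ :=
      dX_le hρ (Nat.zero_le _) le_rfl
    rw [pow_succ] at hMr
    change dX k ρ ⟨0, hk⟩ j ≤ r / 2
    linarith

/-- **Lemma (X is a metric space of doubling dimension log₂ 3).** For `k ≥ 1` and
`ρ ≥ 1`, the distance `d_X` (with `d_X(x_i, x_{i'}) = 2^{max(i,i')}·ρ` for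
`i ≠ i'`) is a metric on `X = {x_1,…,x_k}`, and every closed ball of `(X, d_X)`
is contained in the union of at most three (`= 2 ^ (log₂ 3)`) closed balls of
half its radius. -/
theorem stmt_5 (k : ℕ) (hk : 1 ≤ k) (ρ : ℝ) (hρ : 1 ≤ ρ) :
    ((∀ i i' : Fin k, 0 ≤ dX k ρ i i') ∧
     (∀ i i' : Fin k, dX k ρ i i' = dX k ρ i' i) ∧
     (∀ i i' : Fin k, dX k ρ i i' = 0 ↔ i = i') ∧
     (∀ i i' i'' : Fin k, dX k ρ i i'' ≤ dX k ρ i i' + dX k ρ i' i'')) ∧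
    (∀ (i : Fin k) (r : ℝ), ∃ c₁ c₂ c₃ : Fin k,
      {j : Fin k | dX k ρ i j ≤ r} ⊆
        {j | dX k ρ c₁ j ≤ r / 2} ∪ {j | dX k ρ c₂ j ≤ r / 2} ∪
        {j | dX k ρ c₃ j ≤ r / 2}) := by
  have hρ₀ : 0 < ρ := one_pos.trans_le hρ
  refine ⟨⟨dX_nonneg hρ₀.le, dX_comm ρ, dX_eq_zero_iff hρ₀, dX_triangle hρ₀.le⟩, fun i r => ?_⟩
  obtain ⟨c₁, c₂, h⟩ := exists_ball_subset_two_half_balls hk hρ₀.le i r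
  exact ⟨c₁, c₂, c₂, h.trans Set.subset_union_left⟩
end

section
/- Let (X,d_X) be a finite metric space with |X| = k ≥ 2. Then X can be partitioned into two non-empty subsets P and Q such that diam(X) ≤ (k−1)·d_X(P,Q). -/
/-- The graph joining distinct points of a metric space at distance less than `c`. -/
def distLTGraph (X : Type*) [MetricSpace X] (c : ℝ) : SimpleGraph X where
  Adj x y := x ≠ y ∧ dist x y < c
  symm := ⟨fun x y h => ⟨h.1.symm, by rw [dist_comm]; exact h.2⟩⟩
  loopless := ⟨fun _ h => h.1 rfl⟩

/-- The distance between the distinct ends of a walk whose steps are shorter than `c` is less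
than `c` times the length of the walk. -/
theorem dist_lt_length_mul_of_walk {X : Type*} [MetricSpace X] {c : ℝ} {u v : X}
    (p : (distLTGraph X c).Walk u v) (huv : u ≠ v) : dist u v < p.length * c := by
  induction p with
  | nil => exact absurd rfl huv
  | @cons u w v h q ih =>
    have hlt : dist u w < c := h.2
    have hc : 0 < c := dist_nonneg.trans_lt hlt
    rw [SimpleGraph.Walk.length_cons]
    push_cast
    by_cases hwv : w = v
    · subst hwv
      have : 0 ≤ (q.length : ℝ) * c := by positivity
      linarith
    · linarith [ih hwv, dist_triangle u w v]

/-- A finite nonempty metric space has two points realizing its diameter. -/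
theorem exists_dist_eq_diam_univ (X : Type*) [MetricSpace X] [Finite X] [Nonempty X] :
    ∃ a b : X, dist a b = Metric.diam (Set.univ : Set X) := by
  obtain ⟨⟨a, b⟩, hab⟩ := Finite.exists_max fun z : X × X => dist z.1 z.2
  refine ⟨a, b, le_antisymm ?_ ?_⟩
  · exact Metric.dist_le_diam_of_mem Set.finite_univ.isBounded (Set.mem_univ a) (Set.mem_univ b)
  · exact Metric.diam_le_of_forall_dist_le dist_nonneg fun x _ y _ => hab (x, y)

/-- **Splitting lemma.** Any finite metric space `X` with `|X| = k ≥ 2` can be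
partitioned into two non-empty subsets `P` and `Q` such that
`diam(X) ≤ (k−1) · d_X(P, Q)`, where `d_X(P, Q) = min {dist p q : p ∈ P, q ∈ Q}`. -/
theorem stmt_10 {X : Type*} [MetricSpace X] [Fintype X] (k : ℕ)
    (hcard : Fintype.card X = k) (hk : 2 ≤ k) :
    ∃ P Q : Set X, P.Nonempty ∧ Q.Nonempty ∧ Disjoint P Q ∧ P ∪ Q = Set.univ ∧
      Metric.diam (Set.univ : Set X) ≤
        ((k : ℝ) - 1) * sInf {d : ℝ | ∃ p ∈ P, ∃ q ∈ Q, dist p q = d} := by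
  have hX : Nontrivial X := Fintype.one_lt_card_iff_nontrivial.mp (by omega)
  have hk1 : (0 : ℝ) < (k : ℝ) - 1 := by
    have : (2 : ℝ) ≤ k := by exact_mod_cast hk
    linarith
  obtain ⟨a, b, hab⟩ := exists_dist_eq_diam_univ X
  have hD : 0 < dist a b := by
    obtain ⟨x, y, hxy⟩ := exists_pair_ne X
    rw [hab]
    exact (dist_pos.mpr hxy).trans_le
      (Metric.dist_le_diam_of_mem Set.finite_univ.isBounded (Set.mem_univ x) (Set.mem_univ y))
  set c := dist a b / ((k : ℝ) - 1)
  have hcpos : 0 < c := div_pos hD hk1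
  have hmul : ((k : ℝ) - 1) * c = dist a b := mul_div_cancel₀ _ hk1.ne'
  let G := distLTGraph X c
  have hb : ¬ G.Reachable a b := by
    intro h
    obtain ⟨p, hp⟩ := h.exists_isPath
    have hlen : (p.length : ℝ) + 1 ≤ k := by
      have := hp.length_lt
      rw [hcard] at this
      exact_mod_cast this
    have hlt := dist_lt_length_mul_of_walk p (dist_pos.mp hD)
    have hle : (p.length : ℝ) * c ≤ ((k : ℝ) - 1) * c := by gcongr; linarith
    linarith
  refine ⟨{x | G.Reachable a x}, {x | G.Reachable a x}ᶜ, ⟨a, SimpleGraph.Reachable.refl a⟩,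
    ⟨b, hb⟩, disjoint_compl_right, Set.union_compl_self _, ?_⟩
  rw [← hab, ← hmul]
  refine mul_le_mul_of_nonneg_left (le_csInf ?_ ?_) hk1.le
  · exact ⟨_, a, SimpleGraph.Reachable.refl a, b, hb, rfl⟩
  · rintro _ ⟨p, hp, q, hq, rfl⟩
    by_contra! hlt
    have hpq : p ≠ q := fun h => hq (h ▸ hp)
    have hadj : G.Adj p q := ⟨hpq, hlt⟩
    exact hq (SimpleGraph.Reachable.trans hp hadj.reachable)
end

section
/- Let (X,d_X) and (Y,d_Y) be metric spaces with X finite, |X| = k ≥ 2. Let ρ ≥ 1, 0 < ε ≤ 1, and β = ε/(8k−8). Let P, Q be a partition of X into two non-empty subsets with diam(X) ≤ (k−1)·d_X(P,Q), and let r_X > 0 satisfy r_X/2 < ρ·diam(X). Suppose σ̄ : X → Y is a ρ-matching, σ̄^P_β : P → Y is a (1+β)ρ-matching with d_Y(σ̄(x),σ̄^P_β(x)) ≤ βr_X/ρ² for all x ∈ P, and σ̄^Q_β : Q → Y is a (1+β)ρ-matching with d_Y(σ̄(x),σ̄^Q_β(x)) ≤ βr_X/ρ² for all x ∈ Q. Then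 the map σ̄_ε : X → Y that agrees with σ̄^P_β on P and with σ̄^Q_β on Q is a (1+ε)ρ-matching from X to Y. -/
/-- If `dist a b` equals `d` up to a factor `ρ`, and `a`, `b` are each moved by at most `e` with
`2 * e ≤ ε * d / (2 * ρ)`, then the new distance equals `d` up to a factor `(1 + ε) * ρ`. -/
theorem distortion_of_close {Y : Type*} [PseudoMetricSpace Y] {ρ ε d e : ℝ} {a b a' b' : Y}
    (hρ : 1 ≤ ρ) (hε0 : 0 ≤ ε) (hε1 : ε ≤ 1) (hd : 0 ≤ d)
    (hlower : (1 / ρ) * d ≤ dist a b) (hupper : dist a b ≤ ρ * d)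
    (ha : dist a a' ≤ e) (hb : dist b b' ≤ e) (he : 2 * e ≤ ε * d / (2 * ρ)) :
    (1 / ((1 + ε) * ρ)) * d ≤ dist a' b' ∧ dist a' b' ≤ (1 + ε) * ρ * d := by
  have hρ0 : 0 < ρ := by linarith
  have h₁ : dist a b ≤ dist a a' + dist a' b' + dist b b' := by
    simpa [dist_comm b' b] using dist_triangle4 a a' b' b
  have h₂ : dist a' b' ≤ dist a a' + dist a b + dist b b' := by
    simpa [dist_comm a' a] using dist_triangle4 a' a b b'
  constructor
  · have hfactor : 1 / (1 + ε) ≤ 1 - ε / 2 := by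
      rw [div_le_iff₀ (by linarith)]
      nlinarith
    calc (1 / ((1 + ε) * ρ)) * d = 1 / (1 + ε) * (d / ρ) := by field_simp
      _ ≤ (1 - ε / 2) * (d / ρ) := by gcongr
      _ = (1 / ρ) * d - ε * d / (2 * ρ) := by field_simp
      _ ≤ dist a' b' := by linarith
  · have hεd : ε * d / (2 * ρ) ≤ ε * ρ * d := by
      rw [div_le_iff₀ (by positivity)]
      have : 0 ≤ ε * d := by positivity
      nlinarith [mul_le_mul hρ hρ zero_le_one hρ0.le]
    linarith

/-- Matching bounds are weakened by increasing the distortion. -/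
theorem matching_bounds_mono {c c' d m : ℝ} (hc : 0 < c) (hcc' : c ≤ c') (hd : 0 ≤ d)
    (h : (1 / c) * d ≤ m ∧ m ≤ c * d) : (1 / c') * d ≤ m ∧ m ≤ c' * d :=
  ⟨le_trans (by gcongr) h.1, h.2.trans (by gcongr)⟩

/-- **Combining two partial matchings (Lemma 14 of the paper).** Let `X, Y` be
metric spaces with `X` finite, `|X| = k ≥ 2`, let `ρ ≥ 1`, `0 < ε ≤ 1` and
`β = ε/(8k−8)`.  Let `P, Q` partition `X` into two non-empty subsets with
`diam(X) ≤ (k−1)·d_X(P,Q)`, and let `r_X > 0` satisfy `r_X/2 < ρ·diam(X)`.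
If `σ̄ : X → Y` is a `ρ`-matching, `σ̄^P_β` is a `(1+β)ρ`-matching on `P` with
`d_Y(σ̄ x, σ̄^P_β x) ≤ βr_X/ρ²` on `P`, and `σ̄^Q_β` is a `(1+β)ρ`-matching on
`Q` with `d_Y(σ̄ x, σ̄^Q_β x) ≤ βr_X/ρ²` on `Q`, then the map `σ̄_ε` agreeing
with `σ̄^P_β` on `P` and with `σ̄^Q_β` on `Q` is a `(1+ε)ρ`-matching on `X`. -/
theorem stmt_13 {X Y : Type*} [MetricSpace X] [MetricSpace Y] [Fintype X]
    (k : ℕ) (hcard : Fintype.card X = k) (hk : 2 ≤ k)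
    (ρ ε β : ℝ) (hρ : 1 ≤ ρ) (hε0 : 0 < ε) (hε1 : ε ≤ 1)
    (hβ : β = ε / (8 * (k : ℝ) - 8))
    (P Q : Set X) (hPne : P.Nonempty) (hQne : Q.Nonempty)
    (hdisj : Disjoint P Q) (hunion : P ∪ Q = Set.univ)
    (hsplit : ∀ p ∈ P, ∀ q ∈ Q,
      Metric.diam (Set.univ : Set X) ≤ ((k : ℝ) - 1) * dist p q)
    (rX : ℝ) (hrX0 : 0 < rX)
    (hrX : rX / 2 < ρ * Metric.diam (Set.univ : Set X))
    (σ σP σQ σε : X → Y)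
    (hσ : ∀ x x' : X, (1 / ρ) * dist x x' ≤ dist (σ x) (σ x') ∧
      dist (σ x) (σ x') ≤ ρ * dist x x')
    (hσP : ∀ x ∈ P, ∀ x' ∈ P,
      (1 / ((1 + β) * ρ)) * dist x x' ≤ dist (σP x) (σP x') ∧
      dist (σP x) (σP x') ≤ (1 + β) * ρ * dist x x')
    (hσPclose : ∀ x ∈ P, dist (σ x) (σP x) ≤ β * rX / ρ ^ 2)
    (hσQ : ∀ x ∈ Q, ∀ x' ∈ Q,
      (1 / ((1 + β) * ρ)) * dist x x' ≤ dist (σQ x) (σQ x') ∧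
      dist (σQ x) (σQ x') ≤ (1 + β) * ρ * dist x x')
    (hσQclose : ∀ x ∈ Q, dist (σ x) (σQ x) ≤ β * rX / ρ ^ 2)
    (hεP : ∀ x ∈ P, σε x = σP x) (hεQ : ∀ x ∈ Q, σε x = σQ x) :
    ∀ x x' : X, (1 / ((1 + ε) * ρ)) * dist x x' ≤ dist (σε x) (σε x') ∧
      dist (σε x) (σε x') ≤ (1 + ε) * ρ * dist x x' := by
  have hk2 : (2 : ℝ) ≤ k := by exact_mod_cast hk
  have hk1 : (0 : ℝ) < (k : ℝ) - 1 := by linarith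
  have hρ0 : 0 < ρ := by linarith
  have hβk : β * ((k : ℝ) - 1) = ε / 8 := by
    rw [hβ, show 8 * (k : ℝ) - 8 = 8 * ((k : ℝ) - 1) by ring]
    field_simp
  have hβ0 : 0 < β := by
    rw [hβ]
    exact div_pos hε0 (by linarith)
  have hβε : β ≤ ε := by nlinarith
  have hc0 : 0 < (1 + β) * ρ := by positivity
  have hcc : (1 + β) * ρ ≤ (1 + ε) * ρ := by gcongr
  have hcross : ∀ p ∈ P, ∀ q ∈ Q, (1 / ((1 + ε) * ρ)) * dist p q ≤ dist (σP p) (σQ q) ∧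
      dist (σP p) (σQ q) ≤ (1 + ε) * ρ * dist p q := by
    intro p hp q hq
    refine distortion_of_close hρ hε0.le hε1 dist_nonneg (hσ p q).1 (hσ p q).2
      (hσPclose p hp) (hσQclose q hq) ?_
    have hr : rX ≤ 2 * (ρ * (((k : ℝ) - 1) * dist p q)) := by
      have := mul_le_mul_of_nonneg_left (hsplit p hp q hq) hρ0.le
      linarith
    calc 2 * (β * rX / ρ ^ 2)
        ≤ 2 * (β * (2 * (ρ * (((k : ℝ) - 1) * dist p q))) / ρ ^ 2) := by gcongr
      _ = 4 * (β * ((k : ℝ) - 1)) * dist p q / ρ := by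
        field_simp
        ring
      _ = ε * dist p q / (2 * ρ) := by
        rw [hβk]
        field_simp
        ring
  have hmem : ∀ x, x ∈ P ∨ x ∈ Q := fun x => by
    rw [← Set.mem_union, hunion]
    trivial
  intro x x'
  rcases hmem x with hx | hx <;> rcases hmem x' with hx' | hx'
  · rw [hεP x hx, hεP x' hx']
    exact matching_bounds_mono hc0 hcc dist_nonneg (hσP x hx x' hx')
  · rw [hεP x hx, hεQ x' hx']
    exact hcross x hx x' hx'
  · rw [hεQ x hx, hεP x' hx', dist_comm x, dist_comm (σQ x)]
    exact hcross x' hx' x hx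
  · rw [hεQ x hx, hεQ x' hx']
    exact matching_bounds_mono hc0 hcc dist_nonneg (hσQ x hx x' hx')
end
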